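/- Asymptotically almost no λ-term is in β-normal form: the sequence Nat.card {t : Term // Normal t ∧ size t = n} / L n (as real numbers) tends to 0 as n → ∞. -/

import Mathlib

inductive Term : Type
  | idx : ℕ → Term
  | app : Term → Term → Term
  | abs : Term → Term

def Term.size : Term → ℕ
  | .idx n => n + 1
  | .app t u => t.size + u.size + 1
  | .abs t => t.size + 1

noncomputable def L (n : ℕ) : ℕ := Nat.card {t : Term // t.size = n}

namespace Lambda

mutual
  inductive Neutral : Term → Prop
    | idx (n : ℕ) : Neutral (.idx n)
    | app {t u : Term} : Neutral t → Normal u → Neutral (.app t u)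
  inductive Normal : Term → Prop
    | of {t : Term} : Neutral t → Normal t
    | abs {t : Term} : Normal t → Normal (.abs t)
end

open scoped ENNReal

/-- A term is an index, an application, or an abstraction. -/
def termEquiv : Term ≃ ℕ ⊕ (Term × Term) ⊕ Term where
  toFun
    | .idx n => .inl n
    | .app t u => .inr (.inl (t, u))
    | .abs t => .inr (.inr t)
  invFun
    | .inl n => .idx n
    | .inr (.inl (t, u)) => .app t u
    | .inr (.inr t) => .abs t
  left_inv t := by cases t <;> rfl
  right_inv s := by rcases s with n | ⟨t, u⟩ | t <;> rfl

theorem tsum_term (f : Term → ℝ≥0∞) :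
    ∑' t, f t = ∑' n, f (.idx n) + (∑' t, ∑' u, f (.app t u) + ∑' t, f (.abs t)) := by
  rw [← termEquiv.symm.tsum_eq f,
    ENNReal.summable.tsum_sum ENNReal.summable, ENNReal.summable.tsum_sum ENNReal.summable,
    ENNReal.tsum_prod']
  rfl

theorem tsum_pow_succ (x : ℝ≥0∞) : ∑' n : ℕ, x ^ (n + 1) = x * (1 - x)⁻¹ := by
  simp_rw [pow_succ']
  rw [ENNReal.tsum_mul_left, ENNReal.tsum_geometric]

theorem tsum_pow_size (x : ℝ≥0∞) :
    ∑' t : Term, x ^ t.size = x * (1 - x)⁻¹ +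
      (x * ((∑' t : Term, x ^ t.size) * ∑' t : Term, x ^ t.size) +
        x * ∑' t : Term, x ^ t.size) := by
  conv_lhs => rw [tsum_term]
  rw [← tsum_pow_succ]
  simp only [Term.size, pow_add, pow_one, ENNReal.tsum_mul_right, ENNReal.tsum_mul_left]
  ring

theorem tsum_three_tenths_pow_size : ∑' t : Term, ENNReal.ofReal (3 / 10) ^ t.size = ∞ := by
  by_contra h
  have key := tsum_pow_size (ENNReal.ofReal (3 / 10))
  lift (∑' t : Term, ENNReal.ofReal (3 / 10) ^ t.size) to NNReal using h with s
  have e : (1 - ENNReal.ofReal (3 / 10))⁻¹ = ENNReal.ofReal (10 / 7) := by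
    rw [← ENNReal.ofReal_one, ← ENNReal.ofReal_sub _ (by norm_num),
      ← ENNReal.ofReal_inv_of_pos (by norm_num)]
    norm_num
  rw [e, ← ENNReal.ofReal_coe_nnreal (p := s)] at key
  have hs := s.coe_nonneg
  rw [← ENNReal.ofReal_mul (by positivity), ← ENNReal.ofReal_mul (by positivity),
    ← ENNReal.ofReal_mul (by positivity), ← ENNReal.ofReal_mul (by positivity),
    ← ENNReal.ofReal_add (by positivity) (by positivity),
    ← ENNReal.ofReal_add (by positivity) (by positivity),
    ENNReal.ofReal_eq_ofReal_iff (by positivity) (by positivity)] at key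
  nlinarith [sq_nonneg ((s : ℝ) - 7 / 6)]

theorem finite_size_le (n : ℕ) : {t : Term | t.size ≤ n}.Finite := by
  induction n with
  | zero =>
    refine Set.finite_empty.subset fun t ht => ?_
    cases t <;> simp [Term.size] at ht
  | succ n ih =>
    refine (((Set.finite_Iic n).image Term.idx).union
      ((ih.image2 Term.app ih).union (ih.image Term.abs))).subset fun t ht => ?_
    cases t with
    | idx k => exact .inl ⟨k, by simpa [Term.size] using ht, rfl⟩
    | app t u =>
      simp only [Term.size, Set.mem_ofPred_eq] at ht
      exact .inr (.inl ⟨t, by simp; omega, u, by simp; omega, rfl⟩)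
    | abs t =>
      simp only [Term.size, Set.mem_ofPred_eq] at ht
      exact .inr (.inr ⟨t, by simp; omega, rfl⟩)

instance finite_size_eq (n : ℕ) : Finite {t : Term // t.size = n} :=
  ((finite_size_le n).subset fun _ ht => le_of_eq ht).to_subtype

instance finite_normal_size_eq (n : ℕ) : Finite {t : Term // Normal t ∧ t.size = n} :=
  ((finite_size_le n).subset fun _ ht => le_of_eq ht.2).to_subtype

theorem tsum_pow_size_eq_tsum_L (x : ℝ≥0∞) :
    ∑' t : Term, x ^ t.size = ∑' n, (L n : ℝ≥0∞) * x ^ n := by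
  rw [← (Equiv.sigmaFiberEquiv Term.size).tsum_eq, ENNReal.tsum_sigma']
  refine tsum_congr fun n => ?_
  have (t : {t : Term // t.size = n}) :
      x ^ ((Equiv.sigmaFiberEquiv Term.size) ⟨n, t⟩).size = x ^ n :=
    congrArg (x ^ ·) t.2
  rw [tsum_congr this, ENNReal.tsum_const]
  simp [L, ENat.card_eq_coe_natCard]

theorem exists_pow_le_L : ∃ k, ((16 / 5 : ℝ)) ^ (k + 1) ≤ L k := by
  by_contra! h
  refine ((tsum_pow_size_eq_tsum_L _).symm.trans tsum_three_tenths_pow_size).not_lt ?_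
  have hsum : Summable fun n : ℕ => (16 / 5 : ℝ) * (24 / 25) ^ n :=
    (summable_geometric_of_lt_one (by norm_num) (by norm_num)).mul_left _
  refine lt_of_le_of_lt (ENNReal.tsum_le_tsum fun n => ?_) hsum.tsum_ofReal_lt_top
  rw [← ENNReal.ofReal_natCast, ← ENNReal.ofReal_pow (by norm_num),
    ← ENNReal.ofReal_mul (by positivity)]
  apply ENNReal.ofReal_le_ofReal
  calc (L n : ℝ) * (3 / 10) ^ n ≤ (16 / 5) ^ (n + 1) * (3 / 10) ^ n := by
        gcongr; exact (h n).le
    _ = 16 / 5 * (24 / 25) ^ n := by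
        rw [pow_succ', mul_assoc, ← mul_pow]; norm_num

theorem L_mul_L_le (m n : ℕ) : L m * L n ≤ L (m + n + 1) := by
  rw [L, L, ← Nat.card_prod]
  refine Nat.card_le_card_of_injective
    (fun p => (⟨.app p.1 p.2, by simp [Term.size, p.1.2, p.2.2]⟩ :
      {t : Term // t.size = m + n + 1})) ?_
  rintro ⟨⟨t, _⟩, ⟨u, _⟩⟩ ⟨⟨t', _⟩, ⟨u', _⟩⟩ h
  simpa using h

theorem L_succ_pos (n : ℕ) : 0 < L (n + 1) :=
  have : Nonempty {t : Term // t.size = n + 1} := ⟨⟨.idx n, rfl⟩⟩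
  Nat.card_pos

theorem exists_pow_mul_le_L :
    ∃ c : ℝ, 0 < c ∧ ∀ n, c * (16 / 5) ^ (n + 1) ≤ L (n + 1) := by
  obtain ⟨k, hk⟩ := exists_pow_le_L
  refine ⟨((16 / 5) ^ (k + 1))⁻¹, by positivity, fun n => ?_⟩
  induction n using Nat.strong_induction_on with
  | _ n ih =>
    rcases lt_or_ge n (k + 1) with hn | hn
    · have h1 : (1 : ℝ) ≤ L (n + 1) := by exact_mod_cast L_succ_pos n
      refine le_trans ?_ h1
      rw [inv_mul_le_one₀ (by positivity)]
      exact pow_le_pow_right₀ (by norm_num) (by omega)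
    · obtain ⟨m, rfl⟩ := Nat.exists_eq_add_of_le hn
      have hm := ih m (by omega)
      have hL : (L k : ℝ) * L (m + 1) ≤ L (k + 1 + m + 1) := by
        have := L_mul_L_le k (m + 1)
        rw [show k + (m + 1) + 1 = k + 1 + m + 1 by ring] at this
        exact_mod_cast this
      calc ((16 / 5 : ℝ) ^ (k + 1))⁻¹ * (16 / 5) ^ (k + 1 + m + 1)
          = (16 / 5) ^ (k + 1) * (((16 / 5) ^ (k + 1))⁻¹ * (16 / 5) ^ (m + 1)) := by ring
        _ ≤ L k * L (m + 1) := by gcongr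
        _ ≤ _ := hL

theorem neutral_app_iff {t u : Term} : Neutral (.app t u) ↔ Neutral t ∧ Normal u :=
  ⟨fun h => by cases h with | app h₁ h₂ => exact ⟨h₁, h₂⟩, fun h => .app h.1 h.2⟩

theorem not_neutral_abs {t : Term} : ¬ Neutral (.abs t) := nofun

theorem normal_idx (n : ℕ) : Normal (.idx n) := .of (.idx n)

theorem normal_app_iff {t u : Term} : Normal (.app t u) ↔ Neutral t ∧ Normal u :=
  ⟨fun h => by cases h with | of h => exact neutral_app_iff.1 h,
    fun h => .of (neutral_app_iff.2 h)⟩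

theorem normal_abs_iff {t : Term} : Normal (.abs t) ↔ Normal t :=
  ⟨fun h => by cases h with
    | of h => exact (not_neutral_abs h).elim
    | abs h => exact h, .abs⟩

open Classical in
/-- The weight `x ^ t.size` of a term of size at most `N` satisfying `P`, and `0` otherwise. -/
noncomputable def weight (P : Term → Prop) (x : ℝ≥0∞) (N : ℕ) (t : Term) : ℝ≥0∞ :=
  if P t ∧ t.size ≤ N then x ^ t.size else 0

theorem weight_idx_le (P : Term → Prop) (x : ℝ≥0∞) (N n : ℕ) :
    weight P x N (.idx n) ≤ x ^ (n + 1) := by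
  unfold weight
  split_ifs
  · rfl
  · exact zero_le

theorem weight_app_le {P : Term → Prop} (hP : ∀ t u, P (.app t u) → Neutral t ∧ Normal u)
    (x : ℝ≥0∞) (N : ℕ) (t u : Term) :
    weight P x (N + 1) (.app t u) ≤ x * (weight Neutral x N t * weight Normal x N u) := by
  unfold weight
  split_ifs with h h₁ h₂ h₂
  · exact le_of_eq (by simp only [Term.size]; ring)
  all_goals first
    | exact zero_le
    | (have hn := hP _ _ h.1; have hs := h.2; simp only [Term.size] at hs; grind)

theorem weight_neutral_abs (x : ℝ≥0∞) (N : ℕ) (t : Term) :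
    weight Neutral x N (.abs t) = 0 := by
  simp [weight, not_neutral_abs]

theorem weight_normal_abs (x : ℝ≥0∞) (N : ℕ) (t : Term) :
    weight Normal x (N + 1) (.abs t) = x * weight Normal x N t := by
  have h : (Normal (.abs t) ∧ (Term.abs t).size ≤ N + 1) ↔ (Normal t ∧ t.size ≤ N) := by
    simp [normal_abs_iff, Term.size]
  by_cases ht : Normal t ∧ t.size ≤ N
  · rw [weight, weight, if_pos (h.2 ht), if_pos ht, Term.size, pow_succ']
  · rw [weight, weight, if_neg (mt h.1 ht), if_neg ht, mul_zero]

theorem weight_zero (P : Term → Prop) (x : ℝ≥0∞) (t : Term) : weight P x 0 t = 0 := by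
  cases t <;> simp [weight, Term.size]

theorem tsum_weight_le (N : ℕ) :
    ∑' t, weight Neutral (ENNReal.ofReal (1 / 3)) N t ≤ ENNReal.ofReal 1 ∧
      ∑' t, weight Normal (ENNReal.ofReal (1 / 3)) N t ≤ ENNReal.ofReal (3 / 2) := by
  induction N with
  | zero => simp [weight_zero]
  | succ N ih =>
    obtain ⟨ih₁, ih₂⟩ := ih
    set x := ENNReal.ofReal (1 / 3) with hx
    have hidx (P : Term → Prop) : ∑' n, weight P x (N + 1) (.idx n) ≤ ENNReal.ofReal (1 / 2) := by
      refine (ENNReal.tsum_le_tsum fun n => weight_idx_le P x (N + 1) n).trans (le_of_eq ?_)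
      rw [tsum_pow_succ, hx, ← ENNReal.ofReal_one, ← ENNReal.ofReal_sub _ (by norm_num),
        ← ENNReal.ofReal_inv_of_pos (by norm_num), ← ENNReal.ofReal_mul (by norm_num)]
      norm_num
    have happ {P : Term → Prop} (hP : ∀ t u, P (.app t u) → Neutral t ∧ Normal u) :
        ∑' t, ∑' u, weight P x (N + 1) (.app t u) ≤ ENNReal.ofReal (1 / 2) := by
      refine (ENNReal.tsum_le_tsum fun t => ENNReal.tsum_le_tsum fun u =>
        weight_app_le hP x N t u).trans ?_
      simp only [ENNReal.tsum_mul_left, ENNReal.tsum_mul_right]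
      refine (mul_le_mul_right (mul_le_mul' ih₁ ih₂) x).trans (le_of_eq ?_)
      rw [hx, ← ENNReal.ofReal_mul (by norm_num), ← ENNReal.ofReal_mul (by norm_num)]
      norm_num
    have habs : ∑' t, weight Normal x (N + 1) (.abs t) ≤ ENNReal.ofReal (1 / 2) := by
      simp only [weight_normal_abs, ENNReal.tsum_mul_left]
      refine (mul_le_mul_right ih₂ x).trans (le_of_eq ?_)
      rw [hx, ← ENNReal.ofReal_mul (by norm_num)]
      norm_num
    constructor
    · rw [tsum_term]
      simp only [weight_neutral_abs, tsum_zero, add_zero]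
      refine (add_le_add (hidx _) (happ fun _ _ => neutral_app_iff.1)).trans (le_of_eq ?_)
      rw [← ENNReal.ofReal_add (by norm_num) (by norm_num)]
      norm_num
    · rw [tsum_term]
      refine (add_le_add (hidx _) (add_le_add (happ fun _ _ => normal_app_iff.1) habs)).trans
        (le_of_eq ?_)
      rw [← ENNReal.ofReal_add (by norm_num) (by norm_num),
        ← ENNReal.ofReal_add (by norm_num) (by norm_num)]
      norm_num

theorem card_normal_le (n : ℕ) :
    (Nat.card {t : Term // Normal t ∧ t.size = n} : ℝ) ≤ 3 / 2 * 3 ^ n := by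
  have h : (Nat.card {t : Term // Normal t ∧ t.size = n} : ℝ≥0∞) * ENNReal.ofReal (1 / 3) ^ n ≤
      ENNReal.ofReal (3 / 2) := by
    refine le_trans ?_ (tsum_weight_le n).2
    refine le_trans (le_of_eq ?_) (ENNReal.tsum_comp_le_tsum_of_injective
      (Subtype.val_injective (p := fun t => Normal t ∧ t.size = n)) _)
    have (t : {t : Term // Normal t ∧ t.size = n}) :
        weight Normal (ENNReal.ofReal (1 / 3)) n t = ENNReal.ofReal (1 / 3) ^ n := by
      simp [weight, t.2.1, t.2.2]
    rw [tsum_congr this, ENNReal.tsum_const]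
    simp [ENat.card_eq_coe_natCard]
  rw [← ENNReal.ofReal_natCast, ← ENNReal.ofReal_pow (by norm_num),
    ← ENNReal.ofReal_mul (by positivity), ENNReal.ofReal_le_ofReal_iff (by norm_num),
    div_pow, one_pow, mul_one_div, div_le_iff₀ (by positivity)] at h
  exact h

theorem normal_density_zero :
    Filter.Tendsto
      (fun n : ℕ =>
        (Nat.card {t : Term // Normal t ∧ t.size = n} : ℝ) / (L n : ℝ))
      Filter.atTop (nhds 0) := by
  obtain ⟨c, hc, hL⟩ := exists_pow_mul_le_L
  have hlim : Filter.Tendsto (fun n : ℕ => 3 / 2 / c * (15 / 16 : ℝ) ^ n) Filter.atTop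
      (nhds 0) := by
    simpa using (tendsto_pow_atTop_nhds_zero_of_lt_one (r := (15 / 16 : ℝ))
      (by norm_num) (by norm_num)).const_mul (3 / 2 / c)
  refine squeeze_zero' (.of_forall fun n => by positivity) ?_ hlim
  filter_upwards [Filter.eventually_ge_atTop 1] with n hn
  obtain ⟨m, rfl⟩ := Nat.exists_eq_add_of_le' hn
  calc (Nat.card {t : Term // Normal t ∧ t.size = m + 1} : ℝ) / (L (m + 1) : ℝ)
      ≤ (3 / 2 * 3 ^ (m + 1)) / (c * (16 / 5) ^ (m + 1)) :=
        div_le_div₀ (by positivity) (card_normal_le _) (by positivity) (hL m)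
    _ = 3 / 2 / c * (15 / 16) ^ (m + 1) := by
        rw [mul_div_mul_comm, ← div_pow]; norm_num

end Lambda
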